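/- In two-color Babylon with initial position consisting of p red singleton stacks and q blue singleton stacks, if p+q is odd and 1 ≤ p ≤ 2 with p ≤ q, then the initial position is a first-player win: Alice has a winning strategy (she can keep both colors alive until the end of the game). -/

import Mathlib

/-- A chip color: `true` = red, `false` = blue.  A stack is a nonempty list of
chips, the head of the list being the top chip; the color of a stack is the
color of its top chip.  A position is a finite multiset of stacks. -/
abbrev Stack := List Bool

abbrev Position := Multiset Stack

/-- A legal move replaces two stacks `s` and `t` that have equal length or
equal top color by the single concatenated stack `s ++ t`. -/
def Move (P Q : Position) : Prop :=
  ∃ s t : Stack, s ≠ [] ∧ t ≠ [] ∧ s ∈ P ∧ t ∈ P.erase s ∧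
    (s.length = t.length ∨ s.head? = t.head?) ∧
    Q = (s ++ t) ::ₘ (P.erase s).erase t

/-- Auxiliary predicate, with the number of stacks as fuel: the player to move
wins iff there is a legal move to a position that is not a first-player win. -/
def FirstWinAux : ℕ → Position → Prop
  | 0, _ => False
  | n + 1, P => ∃ Q, Move P Q ∧ ¬ FirstWinAux n Q

/-- The position is a first-player win: the player to move has a winning
strategy.  Since each move decreases the number of stacks by exactly one,
`Multiset.card P` is enough fuel. -/
def FirstWin (P : Position) : Prop := FirstWinAux (Multiset.card P) P

/-- The initial position with `p` red singleton stacks and `q` blue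
singleton stacks. -/
def initPos (p q : ℕ) : Position :=
  Multiset.replicate p [true] + Multiset.replicate q [false]

theorem Move.of_cons_cons {s t : Stack} {R : Position} (hs : s ≠ []) (ht : t ≠ [])
    (h : s.length = t.length ∨ s.head? = t.head?) :
    Move (s ::ₘ t ::ₘ R) ((s ++ t) ::ₘ R) :=
  ⟨s, t, hs, ht, by simp, by simp, h, by simp⟩

/-- When the only red stack has height two, no blue stack has height two and all but one
blue stack are singletons, a move merges two singletons or the other blue stack with a
singleton. -/
theorem Move.eq_of_red_two {r b : Stack} {m : ℕ} {Q : Position}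
    (hr : r.length = 2) (hrc : r.head? = some true)
    (hb : b.length ≠ 2) (hbc : b.head? = some false)
    (h : Move (r ::ₘ b ::ₘ Multiset.replicate m [false]) Q) :
    (∃ k, m = k + 2 ∧ Q = [false, false] ::ₘ r ::ₘ b ::ₘ Multiset.replicate k [false]) ∨
    ∃ k c, m = k + 1 ∧ c.length = b.length + 1 ∧ c.head? = some false ∧
      Q = r ::ₘ c ::ₘ Multiset.replicate k [false] := by
  obtain ⟨s, t, -, -, hs, ht, hst, rfl⟩ := h
  have blue : ∀ u ∈ b ::ₘ Multiset.replicate m [false],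
      u.length ≠ 2 ∧ u.head? = some false := by
    intro u hu
    rcases Multiset.mem_cons.1 hu with rfl | hu
    · exact ⟨hb, hbc⟩
    · rw [Multiset.eq_of_mem_replicate hu]; simp
  have hsr : s ≠ r := by
    rintro rfl
    rw [Multiset.erase_cons_head] at ht
    have := blue t ht
    grind
  have hs' : s ∈ b ::ₘ Multiset.replicate m [false] := (Multiset.mem_cons.1 hs).resolve_left hsr
  rw [Multiset.erase_cons_tail _ hsr.symm] at ht ⊢
  have htr : t ≠ r := by
    rintro rfl
    have := blue s hs'
    grind
  have ht' := (Multiset.mem_cons.1 ht).resolve_left htr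
  rw [Multiset.erase_cons_tail _ htr.symm]
  have mem_pos : ∀ {u : Stack} {n : ℕ}, u ∈ Multiset.replicate n [false] →
      u = [false] ∧ ∃ k, n = k + 1 := by
    intro u n hu
    obtain ⟨h0, rfl⟩ := Multiset.mem_replicate.1 hu
    exact ⟨rfl, Nat.exists_eq_succ_of_ne_zero h0⟩
  by_cases hsb : s = b
  · subst hsb
    rw [Multiset.erase_cons_head] at ht' ⊢
    obtain ⟨rfl, k, rfl⟩ := mem_pos ht'
    refine Or.inr ⟨k, s ++ [false], rfl, by simp, by simp [hbc], ?_⟩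
    rw [Multiset.replicate_succ, Multiset.erase_cons_head, Multiset.cons_swap]
  · obtain ⟨rfl, k, rfl⟩ := mem_pos ((Multiset.mem_cons.1 hs').resolve_left hsb)
    rw [Multiset.erase_cons_tail _ (Ne.symm hsb), Multiset.replicate_succ,
      Multiset.erase_cons_head] at ht' ⊢
    by_cases htb : t = b
    · subst htb
      refine Or.inr ⟨k, [false] ++ t, rfl, by simp, by simp, ?_⟩
      rw [Multiset.erase_cons_head, Multiset.cons_swap]
    · obtain ⟨rfl, j, rfl⟩ := mem_pos ((Multiset.mem_cons.1 ht').resolve_left htb)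
      refine Or.inl ⟨j, rfl, ?_⟩
      rw [Multiset.erase_cons_tail _ (Ne.symm htb), Multiset.replicate_succ,
        Multiset.erase_cons_head]
      rfl

/-- A red stack of height two, a blue stack of height at least three and an even number of
blue singletons: the player to move loses. -/
theorem not_firstWinAux_red_two_blue_tall (k : ℕ) {r b : Stack}
    (hr : r.length = 2) (hrc : r.head? = some true)
    (hb : 3 ≤ b.length) (hbc : b.head? = some false) :
    ¬ FirstWinAux (2 * k + 2) (r ::ₘ b ::ₘ Multiset.replicate (2 * k) [false]) := by
  induction k generalizing b with
  | zero =>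
    rintro ⟨Q, hQ, -⟩
    obtain ⟨j, hj, -⟩ | ⟨j, c, hj, -⟩ := hQ.eq_of_red_two hr hrc (by lia) hbc <;> lia
  | succ k ih =>
    rintro ⟨Q, hQ, hwin⟩
    have hbne : b ≠ [] := by rintro rfl; simp at hb
    apply hwin
    obtain ⟨j, hj, rfl⟩ | ⟨j, c, hj, hc, hcc, rfl⟩ := hQ.eq_of_red_two hr hrc (by lia) hbc
    · obtain rfl : j = 2 * k := by lia
      refine ⟨r ::ₘ (b ++ [false, false]) ::ₘ Multiset.replicate (2 * k) [false], ?_,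
        ih (by simp; lia) (by simp [hbc])⟩
      rw [Multiset.cons_swap r (b ++ _), Multiset.cons_swap r b,
        Multiset.cons_swap [false, false] b]
      exact .of_cons_cons hbne (by simp) (.inr (by simp [hbc]))
    · obtain rfl : j = 2 * k + 1 := by lia
      refine ⟨r ::ₘ (c ++ [false]) ::ₘ Multiset.replicate (2 * k) [false], ?_,
        ih (by simp; lia) (by simp [hcc])⟩
      rw [Multiset.replicate_succ, Multiset.cons_swap r c, Multiset.cons_swap r [false],
        Multiset.cons_swap r (c ++ _)]
      exact .of_cons_cons (by rintro rfl; simp at hcc) (by simp) (.inr (by simp [hcc]))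

/-- A red stack of height two and an odd number of blue singletons: the player to move
loses. -/
theorem not_firstWinAux_red_two_blue_singletons (k : ℕ) {r : Stack}
    (hr : r.length = 2) (hrc : r.head? = some true) :
    ¬ FirstWinAux (2 * k + 2) (r ::ₘ Multiset.replicate (2 * k + 1) [false]) := by
  rintro ⟨Q, hQ, hwin⟩
  rw [Multiset.replicate_succ] at hQ
  obtain ⟨j, c, hj, hc, hcc, rfl⟩ : ∃ j c, 2 * k = j + 1 ∧ c.length = 2 ∧
      c.head? = some false ∧ Q = r ::ₘ c ::ₘ Multiset.replicate j [false] := by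
    obtain ⟨j, hj, rfl⟩ | ⟨j, c, hj, hc, hcc, rfl⟩ :=
      hQ.eq_of_red_two hr hrc (by simp) (by simp)
    · refine ⟨j + 1, [false, false], by lia, rfl, rfl, ?_⟩
      rw [Multiset.replicate_succ, Multiset.cons_swap]
    · exact ⟨j, c, hj, hc, hcc, rfl⟩
  obtain ⟨i, rfl, rfl⟩ : ∃ i, k = i + 1 ∧ j = 2 * i + 1 := ⟨k - 1, by lia, by lia⟩
  refine hwin ⟨r ::ₘ (c ++ [false]) ::ₘ Multiset.replicate (2 * i) [false], ?_,
    not_firstWinAux_red_two_blue_tall i hr hrc (by simp [hc]) (by simp [hcc])⟩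
  rw [Multiset.replicate_succ, Multiset.cons_swap r c, Multiset.cons_swap r [false],
    Multiset.cons_swap r (c ++ _)]
  exact .of_cons_cons (by rintro rfl; simp at hcc) (by simp) (.inr (by simp [hcc]))

/-- If `p + q` is odd, `1 ≤ p ≤ 2` and `p ≤ q`, then the initial position
with `p` red and `q` blue singletons is a first-player win. -/
theorem alice_wins_odd_small (p q : ℕ) (hodd : Odd (p + q))
    (hp1 : 1 ≤ p) (hp2 : p ≤ 2) (hpq : p ≤ q) :
    FirstWin (initPos p q) := by
  obtain rfl | rfl : p = 1 ∨ p = 2 := by lia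
  · obtain ⟨k, rfl⟩ : ∃ k, q = 2 * k + 2 := ⟨q / 2 - 1, by grind⟩
    have hcard : Multiset.card (initPos 1 (2 * k + 2)) = 2 * k + 2 + 1 := by
      simp [initPos]
    rw [FirstWin, hcard]
    refine ⟨_, ?_, not_firstWinAux_red_two_blue_singletons k (r := [true, false]) rfl rfl⟩
    have hpos : initPos 1 (2 * k + 2) =
        [true] ::ₘ [false] ::ₘ Multiset.replicate (2 * k + 1) [false] := by
      simp only [initPos, Multiset.replicate_succ, Multiset.replicate_zero, Multiset.cons_add,
        zero_add]
    rw [hpos]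
    exact .of_cons_cons (s := [true]) (t := [false]) (by simp) (by simp) (.inl rfl)
  · obtain ⟨k, rfl⟩ : ∃ k, q = 2 * k + 1 := ⟨q / 2, by grind⟩
    have hcard : Multiset.card (initPos 2 (2 * k + 1)) = 2 * k + 2 + 1 := by
      simp [initPos]
    rw [FirstWin, hcard]
    refine ⟨_, ?_, not_firstWinAux_red_two_blue_singletons k (r := [true, true]) rfl rfl⟩
    have hpos : initPos 2 (2 * k + 1) =
        [true] ::ₘ [true] ::ₘ Multiset.replicate (2 * k + 1) [false] := by
      simp only [initPos, Multiset.replicate_succ, Multiset.replicate_zero, Multiset.cons_add,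
        zero_add]
    rw [hpos]
    exact .of_cons_cons (s := [true]) (t := [true]) (by simp) (by simp) (.inl rfl)
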